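/- Suppose there is a strictly increasing function f: ℕ → ℝ with 2f(0)+1 > 0 such that for every j ∈ {0,1,…,r+1} and every integer k ≥ 0 there exists a nonzero constant C_{k,j} with lim_{n→∞} (p_n^{[2j]})^{(k)}(c) / ((−1)^n n^{f(k+j)}) = C_{k,j}. Then for all sufficiently large n the connection formula q_n(x) = Σ_{j=0}^{r+1} λ_{j,n} (x−c)^j p_{n−j}^{[2j]}(x) holds with uniquely determined real coefficients λ_{j,n}, and for each j ∈ {0,…,r+1} the limit λ_j = lim_{n→∞} λ_{j,n} exists in ℝ. Moreover, if M_i > 0 for every i = 0,…,r, then λ_j = 0 for j = 0,1,…,r and λ_{r+1} ≠ 0. -/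

import Mathlib

open MeasureTheory Polynomial Filter Topology

noncomputable section

/-- The support of a Borel measure on `ℝ`. -/
def measSupport (μ : Measure ℝ) : Set ℝ := {x | ∀ U ∈ nhds x, μ U ≠ 0}

/-- `P` is a sequence of orthonormal polynomials with respect to the measure `μ`. -/
def IsOPS (μ : Measure ℝ) (P : ℕ → Polynomial ℝ) : Prop :=
  (∀ n, (P n).degree = n) ∧ (∀ n, 0 < (P n).leadingCoeff) ∧
    ∀ n m, (∫ x, (P n).eval x * (P m).eval x ∂μ) = if n = m then 1 else 0

/-- The modified measure `dμ_j(x) = (x-c)^j dμ(x)`. -/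
def muMod (μ : Measure ℝ) (c : ℝ) (j : ℕ) : Measure ℝ :=
  μ.withDensity fun x => ENNReal.ofReal ((x - c) ^ j)

/-- The discrete Sobolev inner product. -/
def sobInner (μ : Measure ℝ) (c : ℝ) (r : ℕ) (M : ℕ → ℝ) (p q : Polynomial ℝ) : ℝ :=
  (∫ x, p.eval x * q.eval x ∂μ) +
    ∑ i ∈ Finset.range (r + 1),
      M i * (Polynomial.derivative^[i] p).eval c * (Polynomial.derivative^[i] q).eval c

/-- `Q` is the sequence of orthonormal polynomials for the Sobolev inner product. -/
def IsSobOPS (μ : Measure ℝ) (c : ℝ) (r : ℕ) (M : ℕ → ℝ) (Q : ℕ → Polynomial ℝ) : Prop :=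
  (∀ n, (Q n).degree = n) ∧ (∀ n, 0 < (Q n).leadingCoeff) ∧
    ∀ n m, sobInner μ c r M (Q n) (Q m) = if n = m then 1 else 0

/-- Orthonormality of a sequence of polynomials, indexed by degree, for a bilinear form. -/
structure IsOrthonormalSeq (B : ℝ[X] →ₗ[ℝ] ℝ[X] →ₗ[ℝ] ℝ) (p : ℕ → ℝ[X]) : Prop where
  degree_eq : ∀ n, (p n).degree = n
  leadingCoeff_pos : ∀ n, 0 < (p n).leadingCoeff
  apply_eq : ∀ n m, B (p n) (p m) = if n = m then 1 else 0

namespace IsOrthonormalSeq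

variable {B : ℝ[X] →ₗ[ℝ] ℝ[X] →ₗ[ℝ] ℝ} {p : ℕ → ℝ[X]}

lemma natDegree_eq (h : IsOrthonormalSeq B p) (n : ℕ) : (p n).natDegree = n :=
  natDegree_eq_of_degree_eq_some (h.degree_eq n)

lemma coeff_pos (h : IsOrthonormalSeq B p) (n : ℕ) : 0 < (p n).coeff n := by
  have := h.leadingCoeff_pos n
  rwa [leadingCoeff, h.natDegree_eq] at this

lemma exists_eq_sum (h : IsOrthonormalSeq B p) (n : ℕ) :
    ∀ t : ℝ[X], t.degree < n → ∃ a : ℕ → ℝ, t = ∑ m ∈ Finset.range n, a m • p m := by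
  induction n with
  | zero =>
    intro t ht
    exact ⟨0, by simpa [Polynomial.degree_lt_iff_coeff_zero, Polynomial.ext_iff] using ht⟩
  | succ n ih =>
    intro t ht
    set b := t.coeff n / (p n).coeff n with hb
    have hlt : (t - b • p n).degree < n := by
      rw [degree_lt_iff_coeff_zero]
      intro m hm
      rcases hm.eq_or_lt with rfl | hm
      · rw [coeff_sub, coeff_smul, smul_eq_mul, hb, div_mul_cancel₀ _ (h.coeff_pos n).ne', sub_self]
      · rw [coeff_sub, coeff_smul, coeff_eq_zero_of_degree_lt, coeff_eq_zero_of_natDegree_lt,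
          smul_zero, sub_zero]
        · rwa [h.natDegree_eq]
        · exact ht.trans_le (by exact_mod_cast hm)
    obtain ⟨a, ha⟩ := ih _ hlt
    refine ⟨Function.update a n b, ?_⟩
    rw [Finset.sum_range_succ, Function.update_self, ← sub_eq_iff_eq_add, ha]
    refine Finset.sum_congr rfl fun m hm => ?_
    rw [Function.update_of_ne (Finset.mem_range.1 hm).ne]

lemma eq_sum (h : IsOrthonormalSeq B p) {n : ℕ} {t : ℝ[X]} (ht : t.degree < n) :
    t = ∑ m ∈ Finset.range n, B t (p m) • p m := by
  obtain ⟨a, ha⟩ := h.exists_eq_sum n t ht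
  conv_lhs => rw [ha]
  refine Finset.sum_congr rfl fun m hm => ?_
  congr 1
  rw [ha]
  simp [h.apply_eq, Finset.mem_range.1 hm]

lemma apply_eq_zero (h : IsOrthonormalSeq B p) {n : ℕ} {t : ℝ[X]} (ht : t.degree < n) :
    B (p n) t = 0 := by
  rw [h.eq_sum ht, map_sum]
  refine Finset.sum_eq_zero fun m hm => ?_
  rw [map_smul, h.apply_eq, if_neg (Finset.mem_range.1 hm).ne', smul_zero]

lemma coeff_eq (h : IsOrthonormalSeq B p) {n : ℕ} {t : ℝ[X]} (ht : t.degree < (n + 1 : ℕ)) :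
    t.coeff n = B t (p n) * (p n).coeff n := by
  conv_lhs => rw [h.eq_sum ht]
  rw [Finset.sum_range_succ, coeff_add, finsetSum_coeff, Finset.sum_eq_zero, zero_add, coeff_smul,
    smul_eq_mul]
  intro m hm
  rw [coeff_smul, coeff_eq_zero_of_natDegree_lt, smul_zero]
  rw [h.natDegree_eq]
  exact Finset.mem_range.1 hm

end IsOrthonormalSeq

/-- The bilinear form `(s, t) ↦ L (w * (s * t))` attached to a moment functional `L`. -/
def momentForm (L : ℝ[X] →ₗ[ℝ] ℝ) (w : ℝ[X]) : ℝ[X] →ₗ[ℝ] ℝ[X] →ₗ[ℝ] ℝ :=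
  (LinearMap.mul ℝ ℝ[X]).compr₂ (L ∘ₗ LinearMap.mulLeft ℝ w)

@[simp]
lemma momentForm_apply (L : ℝ[X] →ₗ[ℝ] ℝ) (w s t : ℝ[X]) :
    momentForm L w s t = L (w * (s * t)) := rfl

/-- Evaluation of the `i`-th derivative at `c`. -/
def evalDeriv (c : ℝ) (i : ℕ) : ℝ[X] →ₗ[ℝ] ℝ := leval c ∘ₗ (derivative ^ i)

lemma evalDeriv_apply (c : ℝ) (i : ℕ) (t : ℝ[X]) :
    evalDeriv c i t = (derivative^[i] t).eval c := by
  simp [evalDeriv, Module.End.pow_apply]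

lemma evalDeriv_X_sub_C_pow_mul (c : ℝ) (k j : ℕ) (t : ℝ[X]) :
    evalDeriv c k ((X - C c) ^ j * t) =
      if j ≤ k then (k.factorial / (k - j).factorial : ℝ) * evalDeriv c (k - j) t else 0 := by
  have key : ∀ (i : ℕ) (s : ℝ[X]), evalDeriv c i s = i.factorial * (taylor c s).coeff i := by
    intro i s
    rw [evalDeriv_apply, ← factorial_smul_hasseDeriv, taylor_coeff]
    simp
  have hX : taylor c (X - C c) = X := by simp
  rw [key, key, taylor_mul, taylor_pow, hX, coeff_X_pow_mul']
  split_ifs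
  · field_simp
  · simp

/-- The Sobolev bilinear form attached to a moment functional `L`. -/
def sobForm (L : ℝ[X] →ₗ[ℝ] ℝ) (c : ℝ) (r : ℕ) (M : ℕ → ℝ) : ℝ[X] →ₗ[ℝ] ℝ[X] →ₗ[ℝ] ℝ :=
  momentForm L 1 + ∑ i ∈ Finset.range (r + 1),
    M i • (LinearMap.mul ℝ ℝ).compl₁₂ (evalDeriv c i) (evalDeriv c i)

lemma sobForm_apply (L : ℝ[X] →ₗ[ℝ] ℝ) (c : ℝ) (r : ℕ) (M : ℕ → ℝ) (s t : ℝ[X]) :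
    sobForm L c r M s t = L (s * t) +
      ∑ i ∈ Finset.range (r + 1), M i * (evalDeriv c i s * evalDeriv c i t) := by
  simp [sobForm, LinearMap.sum_apply]

/-- Triangular elimination of the Taylor coefficients of `q` at `c`. -/
lemma exists_eq_sum_add_X_sub_C_pow_mul (c : ℝ) (p : ℕ → ℝ[X]) (q : ℝ[X]) (s : ℕ)
    (hp : ∀ j < s, (p j).eval c ≠ 0) :
    ∃ (a : ℕ → ℝ) (u : ℝ[X]), q = (∑ j ∈ Finset.range s,
      C (a j) * (X - C c) ^ j * p j) + (X - C c) ^ s * u := by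
  induction s with
  | zero => exact ⟨0, q, by simp⟩
  | succ s ih =>
    obtain ⟨a, u, h⟩ := ih fun j hj => hp j (hj.trans s.lt_succ_self)
    set b := u.eval c / (p s).eval c with hb
    have hroot : (u - C b * p s).IsRoot c := by
      simp [hb, div_mul_cancel₀ _ (hp s s.lt_succ_self)]
    obtain ⟨v, hv⟩ := dvd_iff_isRoot.2 hroot
    refine ⟨Function.update a s b, v, ?_⟩
    have hsum : ∑ j ∈ Finset.range s, C (Function.update a s b j) *
        (X - C c) ^ j * p j =
        ∑ j ∈ Finset.range s, C (a j) * (X - C c) ^ j * p j :=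
      Finset.sum_congr rfl fun j hj => by
        rw [Function.update_of_ne (Finset.mem_range.1 hj).ne]
    rw [Finset.sum_range_succ, Function.update_self, hsum]
    rw [sub_eq_iff_eq_add] at hv
    conv_lhs => rw [h, hv]
    ring

lemma eq_zero_of_sum_X_sub_C_pow_mul_eq_zero (c : ℝ) (s : ℕ) :
    ∀ (p : ℕ → ℝ[X]) (a : ℕ → ℝ), (∀ j < s, (p j).eval c ≠ 0) →
      (∑ j ∈ Finset.range s, C (a j) * (X - C c) ^ j * p j = 0) →
      ∀ j < s, a j = 0 := by
  induction s with
  | zero => intro p a _ _ j hj; omega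
  | succ s ih =>
    intro p a hp h
    rw [Finset.sum_range_succ'] at h
    have h0 : a 0 = 0 := by
      have := congrArg (eval c) h
      simpa [eval_finsetSum, hp 0 s.succ_pos] using this
    have htail : ∑ j ∈ Finset.range s, C (a (j + 1)) * (X - C c) ^ j *
        p (j + 1) = 0 := by
      refine mul_left_cancel₀ (X_sub_C_ne_zero c) ?_
      rw [h0, C_0, zero_mul, zero_mul, add_zero] at h
      rw [mul_zero, Finset.mul_sum, ← h]
      exact Finset.sum_congr rfl fun j _ => by ring
    have := ih (fun j => p (j + 1)) (fun j => a (j + 1)) (fun j hj => hp _ (by omega)) htail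
    rintro (_ | j) hj
    · exact h0
    · exact this j (by omega)

lemma exists_connection_coefficients (L : ℝ[X] →ₗ[ℝ] ℝ) (c : ℝ) (r n : ℕ) (hn : r + 1 ≤ n)
    (P : ℕ → ℕ → ℝ[X])
    (hP : ∀ j ≤ r + 1, IsOrthonormalSeq (momentForm L ((X - C c) ^ (2 * j))) (P j))
    (hPc : ∀ j < r + 1, (P j (n - j)).eval c ≠ 0) (q : ℝ[X]) (hq : q.degree ≤ n)
    (horth : ∀ t : ℝ[X], t.degree < (n - (r + 1) : ℕ) →
      L (q * ((X - C c) ^ (r + 1) * t)) = 0) :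
    ∃ a : ℕ → ℝ, q = ∑ j ∈ Finset.range (r + 2),
      C (a j) * (X - C c) ^ j * P j (n - j) := by
  set D : ℝ[X] := X - C c with hD
  obtain ⟨a, u, hu⟩ := exists_eq_sum_add_X_sub_C_pow_mul c (fun j => P j (n - j)) q (r + 1) hPc
  rw [← hD] at hu
  have hDdeg : ∀ k : ℕ, (D ^ k).degree = k := fun k => by simp [hD, degree_pow]
  have hudeg : u.degree < (n - (r + 1) + 1 : ℕ) := by
    have hle : (D ^ (r + 1) * u).degree ≤ n := by
      rw [← sub_eq_iff_eq_add'.2 hu]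
      refine (degree_sub_le _ _).trans (max_le hq ?_)
      refine (degree_sum_le _ _).trans (Finset.sup_le fun j hj => ?_)
      have hj' := Finset.mem_range.1 hj
      rw [degree_mul, degree_mul, hDdeg, (hP j hj'.le).degree_eq]
      refine (add_le_add_left (add_le_add_left degree_C_le _) _).trans ?_
      rw [zero_add]
      exact_mod_cast (by omega : j + (n - j) ≤ n)
    rw [degree_mul, hDdeg] at hle
    rcases eq_or_ne u 0 with rfl | hu0
    · simp
    rw [degree_eq_natDegree hu0] at hle ⊢
    have : r + 1 + u.natDegree ≤ n := by exact_mod_cast hle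
    exact_mod_cast (by omega : u.natDegree < n - (r + 1) + 1)
  have huexp := (hP (r + 1) le_rfl).eq_sum hudeg
  have hzero : ∀ m ∈ Finset.range (n - (r + 1)),
      momentForm L (D ^ (2 * (r + 1))) u (P (r + 1) m) = 0 := by
    intro m hm
    have hm' := Finset.mem_range.1 hm
    have hmdeg := (hP (r + 1) le_rfl).degree_eq m
    have hq0 := horth (P (r + 1) m) (by rw [hmdeg]; exact_mod_cast hm')
    rw [hu, add_mul, map_add, Finset.sum_mul, map_sum, Finset.sum_eq_zero, zero_add] at hq0
    · rw [momentForm_apply, ← hq0]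
      congr 1
      ring
    · intro j hj
      have hj' := Finset.mem_range.1 hj
      have := (hP j hj'.le).apply_eq_zero (n := n - j) (t := D ^ (r + 1 - j) * P (r + 1) m) (by
        rw [degree_mul, hDdeg, hmdeg]
        exact_mod_cast (by omega : r + 1 - j + m < n - j))
      rw [momentForm_apply] at this
      rw [← smul_zero (a j), ← this, ← map_smul, smul_eq_C_mul]
      congr 1
      rw [show D ^ (r + 1) = D ^ (r + 1 - j) * D ^ j by
        rw [← pow_add, Nat.sub_add_cancel hj'.le]]
      ring
  rw [Finset.sum_range_succ, Finset.sum_eq_zero fun m hm => by rw [hzero m hm, zero_smul],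
    zero_add] at huexp
  set b := momentForm L (D ^ (2 * (r + 1))) u (P (r + 1) (n - (r + 1)))
  refine ⟨Function.update a (r + 1) b, ?_⟩
  rw [Finset.sum_range_succ, Function.update_self]
  conv_lhs => rw [hu, huexp, smul_eq_C_mul]
  congr 1
  · refine Finset.sum_congr rfl fun j hj => ?_
    rw [Function.update_of_ne (Finset.mem_range.1 hj).ne]
  · ring

lemma tendsto_add_one_rpow_sub_rpow_div (e : ℝ) :
    Tendsto (fun n : ℕ => (((n : ℝ) + 1) ^ e - (n : ℝ) ^ e) / (n : ℝ) ^ (e - 1)) atTop (𝓝 e) := by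
  have hd : HasDerivAt (fun x : ℝ => x ^ e) e 1 := by
    simpa using Real.hasDerivAt_rpow_const (x := 1) (p := e) (Or.inl one_ne_zero)
  rw [hasDerivAt_iff_tendsto_slope_zero] at hd
  have hinv : Tendsto (fun n : ℕ => (n : ℝ)⁻¹) atTop (𝓝[≠] 0) := by
    refine tendsto_nhdsWithin_iff.2 ⟨tendsto_inv_atTop_nhds_zero_nat, ?_⟩
    filter_upwards [eventually_gt_atTop 0] with n hn
    simpa using hn.ne'
  refine (hd.comp hinv).congr' ?_
  filter_upwards [eventually_gt_atTop 0] with n hn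
  have hn' : (0 : ℝ) < n := by exact_mod_cast hn
  have hsplit : (n : ℝ) + 1 = n * (1 + (n : ℝ)⁻¹) := by field_simp
  have hpow : (0 : ℝ) < (n : ℝ) ^ e := Real.rpow_pos_of_pos hn' _
  rw [Function.comp_apply, hsplit, Real.mul_rpow hn'.le (by positivity), Real.rpow_sub hn',
    Real.rpow_one, Real.one_rpow, inv_inv, smul_eq_mul]
  field_simp

lemma tendsto_sum_range_div_rpow {u : ℕ → ℝ} {e H : ℝ} (he : 0 < e)
    (hu : Tendsto (fun n : ℕ => u n / (n : ℝ) ^ (e - 1)) atTop (𝓝 H)) :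
    Tendsto (fun n : ℕ => (∑ m ∈ Finset.range n, u m) / (n : ℝ) ^ e) atTop (𝓝 (H / e)) := by
  set g : ℕ → ℝ := fun n => ((n : ℝ) + 1) ^ e - (n : ℝ) ^ e with hg
  have hgpos : ∀ n, 0 < g n := fun n =>
    sub_pos.2 (Real.rpow_lt_rpow (Nat.cast_nonneg n) (by linarith) he)
  have hsum : ∀ n, ∑ m ∈ Finset.range n, g m = (n : ℝ) ^ e := by
    intro n
    have := Finset.sum_range_sub (fun m : ℕ => (m : ℝ) ^ e) n
    simpa [hg, Real.zero_rpow he.ne'] using this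
  have hquot : Tendsto (fun n => u n / g n) atTop (𝓝 (H / e)) := by
    refine (hu.div (tendsto_add_one_rpow_sub_rpow_div e) he.ne').congr' ?_
    filter_upwards [eventually_gt_atTop 0] with n hn
    have hn' : (0 : ℝ) < n := by exact_mod_cast hn
    exact div_div_div_cancel_right₀ (Real.rpow_pos_of_pos hn' _).ne' _ _
  have hlittle : (fun n => u n - H / e * g n) =o[atTop] g := by
    rw [Asymptotics.isLittleO_iff_tendsto fun n hn => absurd hn (hgpos n).ne']
    have := hquot.sub_const (H / e)
    rw [sub_self] at this
    refine this.congr fun n => ?_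
    rw [sub_div, mul_div_cancel_right₀ _ (hgpos n).ne']
  have htop : Tendsto (fun n => ∑ m ∈ Finset.range n, g m) atTop atTop := by
    simp only [hsum]
    exact (tendsto_rpow_atTop he).comp tendsto_natCast_atTop_atTop
  have hlim := (hlittle.sum_range (fun n => (hgpos n).le) htop).tendsto_div_nhds_zero
  simp only [Finset.sum_sub_distrib, ← Finset.mul_sum, hsum] at hlim
  have := hlim.add_const (H / e)
  rw [zero_add] at this
  refine this.congr' ?_
  filter_upwards [eventually_gt_atTop 0] with n hn
  have hn' : (0 : ℝ) < n := by exact_mod_cast hn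
  rw [sub_div, mul_div_cancel_right₀ _ (Real.rpow_pos_of_pos hn' _).ne', sub_add_cancel]

/-- A rational function `d - ∑ h i / (x + f i + 1)` with too many zeros vanishes identically. -/
lemma eq_zero_of_sub_sum_div_eq_zero {f : ℕ → ℝ} (hf : Function.Injective f)
    (hpos : ∀ i k, 0 < f i + f k + 1) {S T : Finset ℕ} {h : ℕ → ℝ} {d : ℝ}
    (hz : ∀ k ∈ T, d - ∑ i ∈ S, h i / (f i + f k + 1) = 0)
    (hcard : S.card < T.card ∨ d = 0 ∧ S.card ≤ T.card) :
    d = 0 ∧ ∀ i ∈ S, h i = 0 := by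
  set p : ℝ[X] := C d * ∏ i ∈ S, (X + C (f i + 1)) -
    ∑ i ∈ S, C (h i) * ∏ l ∈ S.erase i, (X + C (f l + 1)) with hp
  have hprod : ∀ U : Finset ℕ, (∏ i ∈ U, (X + C (f i + 1))).degree = ((U.card : ℕ) : WithBot ℕ) := by
    intro U
    rw [degree_prod]
    simp only [degree_X_add_C]
    simp
  have hCmul : ∀ (a : ℝ) (t : ℝ[X]), (C a * t).degree ≤ t.degree := fun a t => by
    rw [degree_mul]
    simpa using add_le_add_left (degree_C_le (a := a)) t.degree
  have hdeg : p.degree < (T.card : ℕ) := by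
    refine (degree_sub_le _ _).trans_lt (max_lt ?_ ?_)
    · rcases hcard with hc | ⟨rfl, -⟩
      · exact (hCmul _ _).trans_lt (by rw [hprod]; exact_mod_cast hc)
      · simp
    · refine (degree_sum_le _ _).trans_lt
        ((Finset.sup_lt_iff (by exact_mod_cast WithBot.bot_lt_coe (T.card))).2 fun i hi => ?_)
      refine (hCmul _ _).trans_lt ?_
      rw [hprod, Finset.card_erase_of_mem hi]
      have hS := Finset.card_pos.2 ⟨i, hi⟩
      have : S.card - 1 < T.card := by omega
      exact_mod_cast this
  have hp0 : p = 0 := by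
    refine eq_zero_of_degree_lt_of_eval_index_eq_zero (v := f) T hf.injOn hdeg fun k hk => ?_
    have hfac : p.eval (f k) =
        (d - ∑ i ∈ S, h i / (f i + f k + 1)) * ∏ i ∈ S, (f i + f k + 1) := by
      rw [sub_mul, Finset.sum_mul, hp]
      simp only [eval_sub, eval_mul, eval_C, eval_prod, eval_finsetSum, eval_add, eval_X]
      congr 1
      · congr 1
        exact Finset.prod_congr rfl fun i _ => by ring
      · refine Finset.sum_congr rfl fun i hi => ?_
        rw [← Finset.mul_prod_erase S _ hi, ← mul_assoc, div_mul_cancel₀ _ (hpos i k).ne']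
        congr 1
        exact Finset.prod_congr rfl fun l _ => by ring
    rw [hfac, hz k hk, zero_mul]
  have hh : ∀ i ∈ S, h i = 0 := by
    intro i hi
    have hev := congrArg (eval (-(f i + 1))) hp0
    rw [hp] at hev
    simp only [eval_sub, eval_mul, eval_C, eval_prod, eval_finsetSum, eval_add, eval_X,
      eval_zero] at hev
    rw [Finset.prod_eq_zero hi (by ring), Finset.sum_eq_single_of_mem i hi, mul_zero, zero_sub,
      neg_eq_zero, mul_eq_zero] at hev
    · refine hev.resolve_right (Finset.prod_ne_zero_iff.2 fun l hl => ?_)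
      have : f l ≠ f i := hf.ne (Finset.ne_of_mem_erase hl)
      intro h0
      exact this (by linarith)
    · intro l _ hli
      rw [Finset.prod_eq_zero (Finset.mem_erase.2 ⟨hli.symm, hi⟩) (by ring), mul_zero]
  refine ⟨?_, hh⟩
  rcases hcard with hc | ⟨rfl, -⟩
  · obtain ⟨k, hk⟩ := Finset.card_pos.1 (hc.trans_le' (Nat.zero_le _))
    have := hz k hk
    rwa [Finset.sum_eq_zero fun i hi => by rw [hh i hi, zero_div], sub_zero] at this
  · rfl

lemma det_cauchy_ne_zero {f : ℕ → ℝ} (hf : Function.Injective f)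
    (hpos : ∀ i k, 0 < f i + f k + 1) {S : Finset ℕ} {a : ℕ → ℝ} (ha : ∀ i, a i ≠ 0) :
    (Matrix.of fun k i : S => a i * a k / (f i + f k + 1)).det ≠ 0 := by
  intro h0
  obtain ⟨v, hv0, hv⟩ := Matrix.exists_mulVec_eq_zero_iff.2 h0
  refine hv0 (funext fun i => ?_)
  have key := eq_zero_of_sub_sum_div_eq_zero hf hpos (S := S) (T := S) (d := 0)
    (h := fun i => if hi : i ∈ S then a i * v ⟨i, hi⟩ else 0) ?_ (Or.inr ⟨rfl, le_rfl⟩)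
  · have := key.2 i i.2
    simpa [ha] using this
  · intro k hk
    have hk' := congrFun hv ⟨k, hk⟩
    simp only [Matrix.mulVec, dotProduct, Matrix.of_apply, Pi.zero_apply] at hk'
    rw [zero_sub, neg_eq_zero, ← Finset.sum_coe_sort]
    refine mul_left_cancel₀ (ha k) ?_
    rw [mul_zero, ← hk', Finset.mul_sum]
    refine Finset.sum_congr rfl fun l _ => ?_
    simp only [Finset.coe_mem, dif_pos]
    ring

/-- Asymptotics of the solution of a perturbed Cauchy-type linear system. -/
lemma tendsto_of_perturbed_cauchy_system {f : ℕ → ℝ} (hf : Function.Injective f)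
    (hpos : ∀ i k, 0 < f i + f k + 1) (S : Finset ℕ) {a : ℕ → ℝ} (ha : ∀ i, a i ≠ 0)
    {b y w d : ℕ → ℕ → ℝ} {G : ℕ → ℕ → ℕ → ℝ} {α : ℕ → ℝ} (hα : ∀ n, 0 < α n)
    (hb : ∀ k, Tendsto (b k) atTop (𝓝 (a k)))
    (hG : ∀ i k, Tendsto (G i k) atTop (𝓝 (a i * a k / (f i + f k + 1))))
    (hd : ∀ k ∈ S, Tendsto (d k) atTop (𝓝 0))
    (hy : ∀ k, ∀ᶠ n in atTop, y k n = α n * b k n - ∑ i ∈ S, w i n * G i k n)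
    (hyd : ∀ k ∈ S, ∀ᶠ n in atTop, y k n = w k n * d k n)
    (hαb : ∀ᶠ n in atTop, (α n)⁻¹ = α n + ∑ i ∈ S, w i n * b i n / n) :
    ∃ Y : ℕ → ℝ, (∀ k, Tendsto (y k) atTop (𝓝 (Y k))) ∧ (∀ k ∈ S, Y k = 0) ∧
      ∀ k ∉ S, Y k ≠ 0 := by
  set H : Matrix S S ℝ := Matrix.of fun k i => a i * a k / (f i + f k + 1) with hH
  have hdet : H.det ≠ 0 := det_cauchy_ne_zero hf hpos ha
  set A : ℕ → Matrix S S ℝ := fun n =>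
    Matrix.of fun k i => G i k n + if i = k then d k n else 0 with hA
  have hAH : Tendsto A atTop (𝓝 H) := by
    refine tendsto_pi_nhds.2 fun k => tendsto_pi_nhds.2 fun i => ?_
    have h1 : Tendsto (fun n => if i = k then d k n else 0) atTop (𝓝 0) := by
      split_ifs
      · exact hd k k.2
      · exact tendsto_const_nhds
    have h2 := (hG i k).add h1
    rw [add_zero] at h2
    exact h2
  set v : ℕ → ℕ → ℝ := fun i n => w i n / α n with hv
  have hAv : ∀ᶠ n in atTop, (A n).mulVec (fun i : S => v i n) = fun k : S => b k n := by
    have h1 : ∀ᶠ n in atTop, ∀ k ∈ S, y k n = α n * b k n - ∑ i ∈ S, w i n * G i k n :=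
      (Filter.eventually_all_finset S).2 fun k _ => hy k
    have h2 := (Filter.eventually_all_finset S).2 hyd
    filter_upwards [h1, h2] with n h1 h2
    funext k
    have e := (h2 k k.2).symm.trans (h1 k k.2)
    simp only [hA, Matrix.mulVec, dotProduct, Matrix.of_apply, add_mul, Finset.sum_add_distrib,
      ite_mul, zero_mul, Finset.sum_ite_eq', Finset.mem_univ, if_true, hv]
    rw [Finset.sum_coe_sort S (fun i => G i k n * (w i n / α n))]
    have hα' := (hα n).ne'
    have : ∑ i ∈ S, G i k n * (w i n / α n) = (∑ i ∈ S, w i n * G i k n) / α n := by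
      rw [Finset.sum_div]
      exact Finset.sum_congr rfl fun i _ => by ring
    rw [this]
    field_simp
    linarith
  have hvlim : ∀ i ∈ S, ∃ h, Tendsto (v i) atTop (𝓝 h) := by
    intro i hi
    have hdetlim : Tendsto (fun n => (A n).det) atTop (𝓝 H.det) :=
      (Continuous.matrix_det continuous_id).continuousAt.tendsto.comp hAH
    have hadj : Tendsto (fun n => (A n).adjugate) atTop (𝓝 H.adjugate) :=
      (Continuous.matrix_adjugate continuous_id).continuousAt.tendsto.comp hAH
    have hnum : Tendsto (fun n => (∑ k : S, (A n).adjugate ⟨i, hi⟩ k * b k n) / (A n).det) atTop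
        (𝓝 ((∑ k : S, H.adjugate ⟨i, hi⟩ k * a k) / H.det)) := by
      refine Tendsto.div (tendsto_finsetSum _ fun k _ => ?_) hdetlim hdet
      exact ((tendsto_pi_nhds.1 (tendsto_pi_nhds.1 hadj ⟨i, hi⟩)) k).mul (hb k)
    refine ⟨_, hnum.congr' ?_⟩
    filter_upwards [hAv, hdetlim.eventually_ne hdet] with n h1 h2
    have h3 := congrArg ((A n).adjugate.mulVec) h1
    simp only [Matrix.mulVec_mulVec, Matrix.adjugate_mul, Matrix.smul_mulVec,
      Matrix.one_mulVec] at h3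
    have h4 := congrFun h3 ⟨i, hi⟩
    simp only [Pi.smul_apply, smul_eq_mul, Matrix.mulVec, dotProduct] at h4
    rw [← h4, mul_div_cancel_left₀ _ h2]
  choose! h hvh using hvlim
  have hα1 : Tendsto α atTop (𝓝 1) := by
    have hsq : Tendsto (fun n => (α n)⁻¹ ^ 2) atTop (𝓝 1) := by
      have : Tendsto (fun n : ℕ => 1 + ∑ i ∈ S, v i n * b i n / (n : ℝ)) atTop (𝓝 (1 + ∑ i ∈ S, 0)) :=
        (tendsto_finsetSum _ fun i hi =>
          ((hvh i hi).mul (hb i)).div_atTop tendsto_natCast_atTop_atTop).const_add 1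
      rw [Finset.sum_const_zero, add_zero] at this
      refine this.congr' ?_
      filter_upwards [hαb] with n hn
      have hα' := (hα n).ne'
      have : ∑ i ∈ S, v i n * b i n / n = (∑ i ∈ S, w i n * b i n / n) / α n := by
        rw [Finset.sum_div]
        exact Finset.sum_congr rfl fun i _ => by rw [hv]; ring
      rw [this, pow_two]
      nth_rewrite 2 [hn]
      field_simp
    have hinv := (Real.continuous_sqrt.tendsto 1).comp hsq
    rw [Real.sqrt_one] at hinv
    have := hinv.inv₀ one_ne_zero
    rw [inv_one] at this
    refine this.congr fun n => ?_
    rw [Function.comp_apply, Real.sqrt_sq (inv_pos.2 (hα n)).le, inv_inv]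
  have hylim : ∀ k, Tendsto (y k) atTop
      (𝓝 (a k - ∑ i ∈ S, h i * (a i * a k / (f i + f k + 1)))) := by
    intro k
    have := hα1.mul ((hb k).sub (tendsto_finsetSum S fun i hi => (hvh i hi).mul (hG i k)))
    rw [one_mul] at this
    refine this.congr' ?_
    filter_upwards [hy k] with n hn
    rw [hn, mul_sub, Finset.mul_sum]
    congr 1
    refine Finset.sum_congr rfl fun i _ => ?_
    have hα' := (hα n).ne'
    rw [hv]
    field_simp
  have hYzero : ∀ k ∈ S, a k - ∑ i ∈ S, h i * (a i * a k / (f i + f k + 1)) = 0 := by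
    intro k hk
    refine tendsto_nhds_unique (hylim k) ?_
    have := (hα1.mul (hvh k hk)).mul (hd k hk)
    rw [mul_zero] at this
    refine this.congr' ?_
    filter_upwards [hyd k hk] with n hn
    have hα' := (hα n).ne'
    rw [hn, hv]
    field_simp
  refine ⟨_, hylim, hYzero, fun k hk hk0 => ?_⟩
  refine one_ne_zero (α := ℝ) (eq_zero_of_sub_sum_div_eq_zero hf hpos (S := S) (T := insert k S)
    (h := fun i => h i * a i) (d := 1) (fun l hl => ?_)
    (Or.inl (by rw [Finset.card_insert_of_notMem hk]; exact Nat.lt_succ_self _))).1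
  have hl0 : a l - ∑ i ∈ S, h i * (a i * a l / (f i + f l + 1)) = 0 := by
    rcases Finset.mem_insert.1 hl with rfl | hl
    · exact hk0
    · exact hYzero l hl
  refine mul_left_cancel₀ (ha l) ?_
  rw [mul_zero, ← hl0, mul_sub, mul_one, Finset.mul_sum]
  congr 1
  exact Finset.sum_congr rfl fun i _ => by ring

/-- Forward substitution preserves convergence. -/
lemma exists_tendsto_of_triangular {R : ℕ} {A : ℕ → ℕ → ℕ → ℝ} {A' : ℕ → ℕ → ℝ}
    {y lam : ℕ → ℕ → ℝ} {Y : ℕ → ℝ}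
    (hA : ∀ k ≤ R, ∀ j ≤ k, Tendsto (A k j) atTop (𝓝 (A' k j))) (hdiag : ∀ k ≤ R, A' k k ≠ 0)
    (hy : ∀ k ≤ R, Tendsto (y k) atTop (𝓝 (Y k)))
    (heq : ∀ k ≤ R, ∀ᶠ n in atTop, y k n = ∑ j ∈ Finset.range (k + 1), A k j n * lam n j) :
    ∃ l : ℕ → ℝ, (∀ k ≤ R, Tendsto (fun n => lam n k) atTop (𝓝 (l k))) ∧
      ∀ k ≤ R, Y k = ∑ j ∈ Finset.range (k + 1), A' k j * l j := by
  have hlim : ∀ k ≤ R, ∃ l, Tendsto (fun n => lam n k) atTop (𝓝 l) := by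
    intro k
    induction k using Nat.strong_induction_on with
    | _ k ih =>
      intro hk
      choose! l hl using ih
      refine ⟨_, Tendsto.congr' ?_ (((hy k hk).sub (tendsto_finsetSum (Finset.range k)
        fun j hj => (hA k hk j (Finset.mem_range.1 hj).le).mul
          (hl j (Finset.mem_range.1 hj) ((Finset.mem_range.1 hj).le.trans hk)))).div
        (hA k hk k le_rfl) (hdiag k hk))⟩
      filter_upwards [heq k hk, (hA k hk k le_rfl).eventually_ne (hdiag k hk)] with n h1 h2
      rw [Pi.div_apply, h1, Finset.sum_range_succ, add_sub_cancel_left, mul_div_cancel_left₀ _ h2]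
  choose! l hl using hlim
  refine ⟨l, hl, fun k hk => tendsto_nhds_unique (hy k hk) ?_⟩
  refine Tendsto.congr' ?_ (tendsto_finsetSum (Finset.range (k + 1)) fun j hj =>
    (hA k hk j (Nat.lt_succ_iff.1 (Finset.mem_range.1 hj))).mul
      (hl j ((Nat.lt_succ_iff.1 (Finset.mem_range.1 hj)).trans hk)))
  filter_upwards [heq k hk] with n h1
  exact h1.symm

lemma tendsto_shift_div_rpow {u : ℕ → ℝ} {e K : ℝ} (j : ℕ)
    (hu : Tendsto (fun n : ℕ => u n / ((-1 : ℝ) ^ n * (n : ℝ) ^ e)) atTop (𝓝 K)) :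
    Tendsto (fun n : ℕ => u (n - j) / ((-1 : ℝ) ^ n * (n : ℝ) ^ e)) atTop
      (𝓝 (K * (-1) ^ j)) := by
  have hratio : Tendsto (fun n : ℕ => 1 - (j : ℝ) / n) atTop (𝓝 1) := by
    simpa using (tendsto_const_div_atTop_nhds_zero_nat (j : ℝ)).const_sub 1
  have hpow := hratio.rpow_const (p := e) (Or.inl one_ne_zero)
  rw [Real.one_rpow] at hpow
  have := ((hu.comp (tendsto_sub_atTop_nat j)).mul_const ((-1 : ℝ) ^ j)).mul hpow
  rw [mul_one] at this
  refine this.congr' ?_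
  filter_upwards [eventually_gt_atTop j] with n hn
  obtain ⟨m, rfl⟩ := Nat.exists_eq_add_of_lt hn
  have hm : j + m + 1 - j = m + 1 := by omega
  have hm0 : (0 : ℝ) < ((m + 1 : ℕ) : ℝ) := by positivity
  have hn0 : (0 : ℝ) < ((j + m + 1 : ℕ) : ℝ) := by positivity
  have hquot : 1 - (j : ℝ) / ((j + m + 1 : ℕ) : ℝ) = ((m + 1 : ℕ) : ℝ) / ((j + m + 1 : ℕ) : ℝ) := by
    rw [eq_div_iff hn0.ne', sub_mul, div_mul_cancel₀ _ hn0.ne']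
    push_cast
    ring
  have h1 := (Real.rpow_pos_of_pos hm0 e).ne'
  have h2 := (Real.rpow_pos_of_pos hn0 e).ne'
  have hsign : (-1 : ℝ) ^ j * (-1) ^ j = 1 := by rw [← mul_pow]; norm_num
  have hsign' : (-1 : ℝ) ^ (j + m + 1) = (-1) ^ j * (-1) ^ (m + 1) := by rw [← pow_add, add_assoc]
  have hj0 : (-1 : ℝ) ^ j ≠ 0 := by positivity
  have hm1 : (-1 : ℝ) ^ (m + 1) ≠ 0 := pow_ne_zero _ (by norm_num)
  rw [Function.comp_apply, hm, hquot, Real.div_rpow hm0.le hn0.le, hsign']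
  generalize (-1 : ℝ) ^ j = ε at *
  generalize (-1 : ℝ) ^ (m + 1) = δ at *
  field_simp
  rw [pow_two, hsign, mul_one]

/-- Asymptotics at `c` of the derivatives of Sobolev orthonormal polynomials. -/
lemma tendsto_evalDeriv_sobolev (L : ℝ[X] →ₗ[ℝ] ℝ) (c : ℝ) (r : ℕ) {M : ℕ → ℝ}
    (hM : ∀ i ≤ r, 0 ≤ M i) {p q : ℕ → ℝ[X]} (hp : IsOrthonormalSeq (momentForm L 1) p)
    (hq : IsOrthonormalSeq (sobForm L c r M) q) {f : ℕ → ℝ} (hf : StrictMono f)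
    (hf0 : 0 < 2 * f 0 + 1) {a : ℕ → ℝ} (ha : ∀ k, a k ≠ 0)
    (hlim : ∀ k, Tendsto (fun n : ℕ => evalDeriv c k (p n) / ((-1 : ℝ) ^ n * (n : ℝ) ^ f k))
      atTop (𝓝 (a k))) :
    ∃ Y : ℕ → ℝ, (∀ k, Tendsto
        (fun n : ℕ => evalDeriv c k (q n) / ((-1 : ℝ) ^ n * (n : ℝ) ^ f k)) atTop (𝓝 (Y k))) ∧
      (∀ k ≤ r, 0 < M k → Y k = 0) ∧ ∀ k > r, Y k ≠ 0 := by
  have hpos : ∀ i k, 0 < f i + f k + 1 := fun i k => by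
    have h1 := hf.monotone (Nat.zero_le i)
    have h2 := hf.monotone (Nat.zero_le k)
    linarith
  set S := (Finset.range (r + 1)).filter (fun i => 0 < M i) with hS
  have hsumS : ∀ g : ℕ → ℝ, ∑ i ∈ Finset.range (r + 1), M i * g i = ∑ i ∈ S, M i * g i := by
    intro g
    refine (Finset.sum_subset (Finset.filter_subset _ _) fun i hi hiS => ?_).symm
    have h1 := hM i (Nat.lt_succ_iff.1 (Finset.mem_range.1 hi))
    have h2 : ¬ 0 < M i := fun h => hiS (Finset.mem_filter.2 ⟨hi, h⟩)
    rw [le_antisymm (not_lt.1 h2) h1, zero_mul]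
  have hpdeg : ∀ n, (p n).degree < ((n + 1 : ℕ) : WithBot ℕ) := fun n => by
    rw [hp.degree_eq]; exact_mod_cast n.lt_succ_self
  have hqdeg : ∀ n, (q n).degree < ((n + 1 : ℕ) : WithBot ℕ) := fun n => by
    rw [hq.degree_eq]; exact_mod_cast n.lt_succ_self
  set α : ℕ → ℝ := fun n => momentForm L 1 (q n) (p n) with hα
  have hcoeff : ∀ n, (q n).coeff n = α n * (p n).coeff n := fun n => hp.coeff_eq (hqdeg n)
  have hαpos : ∀ n, 0 < α n := fun n =>
    pos_of_mul_pos_left (hcoeff n ▸ hq.coeff_pos n) (hp.coeff_pos n).le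
  have hαinv : ∀ n, (α n)⁻¹ =
      α n + ∑ i ∈ S, M i * (evalDeriv c i (p n) * evalDeriv c i (q n)) := by
    intro n
    have h1 := hq.coeff_eq (hpdeg n)
    rw [hcoeff n, sobForm_apply, hsumS, ← mul_assoc] at h1
    have h2 := mul_right_cancel₀ (hp.coeff_pos n).ne' ((one_mul _).trans h1)
    have hL : L (p n * q n) = α n := by simp only [hα, momentForm_apply, one_mul, mul_comm (q n)]
    rw [hL] at h2
    exact inv_eq_of_mul_eq_one_left h2.symm
  have hexp : ∀ k n, evalDeriv c k (q n) = α n * evalDeriv c k (p n) -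
      ∑ i ∈ S, M i * evalDeriv c i (q n) *
        ∑ m ∈ Finset.range n, evalDeriv c i (p m) * evalDeriv c k (p m) := by
    intro k n
    conv_lhs => rw [hp.eq_sum (hqdeg n), Finset.sum_range_succ, map_add, map_sum, map_smul]
    have hcoef : ∀ m ∈ Finset.range n, evalDeriv c k (momentForm L 1 (q n) (p m) • p m) =
        -∑ i ∈ S, M i * evalDeriv c i (q n) * (evalDeriv c i (p m) * evalDeriv c k (p m)) := by
      intro m hm
      have h1 := hq.apply_eq_zero (n := n) (t := p m) (by
        rw [hp.degree_eq]; exact_mod_cast Finset.mem_range.1 hm)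
      rw [sobForm_apply, hsumS] at h1
      rw [momentForm_apply, one_mul, map_smul, smul_eq_mul, eq_neg_of_add_eq_zero_left h1,
        neg_mul, Finset.sum_mul]
      congr 1
      exact Finset.sum_congr rfl fun i _ => by ring
    rw [Finset.sum_congr rfl hcoef, Finset.sum_neg_distrib, Finset.sum_comm, smul_eq_mul]
    simp only [Finset.mul_sum]
    ring
  have hcast : ∀ {n : ℕ}, 0 < n → (0 : ℝ) < n := fun h => by exact_mod_cast h
  refine (tendsto_of_perturbed_cauchy_system hf.injective hpos S ha
    (b := fun k n => evalDeriv c k (p n) / ((-1 : ℝ) ^ n * (n : ℝ) ^ f k))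
    (y := fun k n => evalDeriv c k (q n) / ((-1 : ℝ) ^ n * (n : ℝ) ^ f k))
    (w := fun i n => M i * (n : ℝ) ^ (f i + f i + 1) *
      (evalDeriv c i (q n) / ((-1 : ℝ) ^ n * (n : ℝ) ^ f i)))
    (d := fun k n => (M k * (n : ℝ) ^ (f k + f k + 1))⁻¹)
    (G := fun i k n => (∑ m ∈ Finset.range n, evalDeriv c i (p m) * evalDeriv c k (p m)) /
      (n : ℝ) ^ (f i + f k + 1))
    hαpos hlim ?_ ?_ ?_ ?_ ?_).imp fun Y hY => ⟨hY.1, fun k hk hMk => hY.2.1 k ?_,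
      fun k hk => hY.2.2 k fun hkS => ?_⟩
  · intro i k
    refine tendsto_sum_range_div_rpow (hpos i k) ?_
    refine ((hlim i).mul (hlim k)).congr' ?_
    filter_upwards [eventually_gt_atTop 0] with n hn
    rw [add_sub_cancel_right, Real.rpow_add (hcast hn), div_mul_div_comm]
    congr 1
    rw [mul_mul_mul_comm, ← mul_pow]
    norm_num
  · intro k hk
    have hMk := (Finset.mem_filter.1 hk).2
    exact (((tendsto_rpow_atTop (hpos k k)).comp tendsto_natCast_atTop_atTop).const_mul_atTop
      hMk).inv_tendsto_atTop
  · intro k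
    filter_upwards [eventually_gt_atTop 0] with n hn
    have hn' := hcast hn
    rw [hexp k n, sub_div, mul_div_assoc, Finset.sum_div]
    congr 1
    refine Finset.sum_congr rfl fun i _ => ?_
    have hi := (Real.rpow_pos_of_pos hn' (f i)).ne'
    have hk := (Real.rpow_pos_of_pos hn' (f k)).ne'
    rw [Real.rpow_add hn', Real.rpow_add hn', Real.rpow_add hn', Real.rpow_add hn', Real.rpow_one]
    field_simp
  · intro k hk
    have hMk := (Finset.mem_filter.1 hk).2.ne'
    filter_upwards [eventually_gt_atTop 0] with n hn
    have := (Real.rpow_pos_of_pos (hcast hn) (f k + f k + 1)).ne'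
    field_simp
  · filter_upwards [eventually_gt_atTop 0] with n hn
    have hn' := hcast hn
    rw [hαinv n]
    congr 1
    refine Finset.sum_congr rfl fun i _ => ?_
    have hi := (Real.rpow_pos_of_pos hn' (f i)).ne'
    have hsign : ((-1 : ℝ) ^ n) ^ 2 = 1 := by rw [← pow_mul, mul_comm, pow_mul]; norm_num
    have hsign0 : (-1 : ℝ) ^ n ≠ 0 := pow_ne_zero _ (by norm_num)
    rw [Real.rpow_add hn', Real.rpow_add hn', Real.rpow_one]
    generalize (-1 : ℝ) ^ n = ε at *
    field_simp
    rw [hsign]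
    ring
  · exact Finset.mem_filter.2 ⟨Finset.mem_range.2 (Nat.lt_succ_iff.2 hk), hMk⟩
  · have := Finset.mem_range.1 (Finset.mem_filter.1 hkS).1
    omega

/-- Integration of polynomials against a measure with finite moments, as a linear functional. -/
def momentFunctional (μ : Measure ℝ) (hint : ∀ p : ℝ[X], Integrable (fun x => p.eval x) μ) :
    ℝ[X] →ₗ[ℝ] ℝ where
  toFun p := ∫ x, p.eval x ∂μ
  map_add' p q := by simp only [eval_add]; exact integral_add (hint p) (hint q)
  map_smul' a p := by simp only [eval_smul, smul_eq_mul, RingHom.id_apply, integral_const_mul]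

lemma IsOPS.isOrthonormalSeq {μ : Measure ℝ}
    (hint : ∀ p : ℝ[X], Integrable (fun x => p.eval x) μ) {c : ℝ} {j : ℕ} {P : ℕ → ℝ[X]}
    (h : IsOPS (muMod μ c (2 * j)) P) :
    IsOrthonormalSeq (momentForm (momentFunctional μ hint) ((X - C c) ^ (2 * j))) P := by
  refine ⟨h.1, h.2.1, fun n m => ?_⟩
  rw [← h.2.2 n m, muMod, integral_withDensity_eq_integral_toReal_smul (by fun_prop)
    (ae_of_all _ fun x => ENNReal.ofReal_lt_top)]
  simp only [momentForm_apply, momentFunctional, LinearMap.coe_mk, AddHom.coe_mk]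
  refine integral_congr_ae (ae_of_all _ fun x => ?_)
  have hx : 0 ≤ (x - c) ^ (2 * j) := by rw [pow_mul]; positivity
  simp [ENNReal.toReal_ofReal hx]

lemma IsSobOPS.isOrthonormalSeq {μ : Measure ℝ}
    (hint : ∀ p : ℝ[X], Integrable (fun x => p.eval x) μ) {c : ℝ} {r : ℕ} {M : ℕ → ℝ}
    {Q : ℕ → ℝ[X]} (h : IsSobOPS μ c r M Q) :
    IsOrthonormalSeq (sobForm (momentFunctional μ hint) c r M) Q := by
  refine ⟨h.1, h.2.1, fun n m => ?_⟩
  rw [← h.2.2 n m, sobForm_apply, sobInner]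
  simp [momentFunctional, evalDeriv_apply, mul_assoc]

lemma IsOrthonormalSeq.apply_mul_X_sub_C_pow_eq_zero {L : ℝ[X] →ₗ[ℝ] ℝ} {c : ℝ} {r : ℕ}
    {M : ℕ → ℝ} {q : ℕ → ℝ[X]} (hq : IsOrthonormalSeq (sobForm L c r M) q) {n : ℕ}
    (hn : r + 1 ≤ n) {t : ℝ[X]} (ht : t.degree < (n - (r + 1) : ℕ)) :
    L (q n * ((X - C c) ^ (r + 1) * t)) = 0 := by
  have h := hq.apply_eq_zero (n := n) (t := (X - C c) ^ (r + 1) * t) (by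
    rcases eq_or_ne t 0 with rfl | ht0
    · simp
    rw [degree_mul, degree_pow, degree_X_sub_C, degree_eq_natDegree ht0]
    rw [degree_eq_natDegree ht0] at ht
    have : t.natDegree < n - (r + 1) := by exact_mod_cast ht
    rw [nsmul_one]
    exact_mod_cast (by omega : r + 1 + t.natDegree < n))
  rwa [sobForm_apply, Finset.sum_eq_zero, add_zero] at h
  intro i hi
  rw [evalDeriv_X_sub_C_pow_mul, if_neg (not_le.2 (Finset.mem_range.1 hi)), mul_zero, mul_zero]

/-- **Theorem 2.** If `(p_n^{[2j]})^{(k)}(c) ≅ C_{k,j} (-1)^n n^{f(k+j)}` for a strictly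
increasing `f` with `2f(0)+1 > 0`, then for large `n` the connection formula
`q_n = Σ_{j=0}^{r+1} λ_{j,n} (x-c)^j p_{n-j}^{[2j]}` holds with uniquely determined
coefficients, each `λ_{j,n}` has a finite limit `λ_j`, and if all masses are positive
then `λ_j = 0` for `j ≤ r` while `λ_{r+1} ≠ 0`. -/
theorem connection_coefficients_limits
    (μ : Measure ℝ) [IsFiniteMeasure μ]
    (hsupp : (measSupport μ).Infinite)
    (hint : ∀ p : Polynomial ℝ, Integrable (fun x => p.eval x) μ)
    (c : ℝ) (r : ℕ) (M : ℕ → ℝ) (hM : ∀ i ≤ r, 0 ≤ M i)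
    (P : ℕ → ℕ → Polynomial ℝ)
    (hP : ∀ j ≤ r + 1, IsOPS (muMod μ c (2 * j)) (P j))
    (q : ℕ → Polynomial ℝ) (hq : IsSobOPS μ c r M q)
    (f : ℕ → ℝ) (hf : StrictMono f) (hf0 : 0 < 2 * f 0 + 1)
    (C : ℕ → ℕ → ℝ) (hC : ∀ k, ∀ j ≤ r + 1, C k j ≠ 0)
    (hlim : ∀ k, ∀ j ≤ r + 1, Filter.Tendsto
      (fun n : ℕ =>
        (Polynomial.derivative^[k] (P j n)).eval c / ((-1 : ℝ) ^ n * (n : ℝ) ^ (f (k + j))))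
      Filter.atTop (nhds (C k j))) :
    ∃ N : ℕ, ∃ lam : ℕ → ℕ → ℝ,
      (∀ n ≥ N,
        (q n = ∑ j ∈ Finset.range (r + 2),
          Polynomial.C (lam n j) * (Polynomial.X - Polynomial.C c) ^ j * P j (n - j)) ∧
        ∀ lam' : ℕ → ℝ,
          (q n = ∑ j ∈ Finset.range (r + 2),
            Polynomial.C (lam' j) * (Polynomial.X - Polynomial.C c) ^ j * P j (n - j)) →
          ∀ j ≤ r + 1, lam' j = lam n j) ∧
      ∀ j ≤ r + 1, ∃ L : ℝ,
        Filter.Tendsto (fun n : ℕ => lam n j) Filter.atTop (nhds L) ∧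
        ((∀ i ≤ r, 0 < M i) → ((j ≤ r → L = 0) ∧ (j = r + 1 → L ≠ 0))) := by
  set L := momentFunctional μ hint
  have hP' : ∀ j ≤ r + 1, IsOrthonormalSeq (momentForm L ((X - Polynomial.C c) ^ (2 * j))) (P j) :=
    fun j hj => (hP j hj).isOrthonormalSeq hint
  have hq' : IsOrthonormalSeq (sobForm L c r M) q := hq.isOrthonormalSeq hint
  have hlim' : ∀ k, ∀ j ≤ r + 1, Tendsto (fun n : ℕ =>
      evalDeriv c k (P j n) / ((-1 : ℝ) ^ n * (n : ℝ) ^ f (k + j))) atTop (𝓝 (C k j)) := by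
    simpa only [evalDeriv_apply] using hlim
  have hne : ∀ᶠ n in atTop, ∀ j ∈ Finset.range (r + 2), (P j (n - j)).eval c ≠ 0 := by
    refine (Filter.eventually_all_finset _).2 fun j hj => ?_
    have hj' := Nat.lt_succ_iff.1 (Finset.mem_range.1 hj)
    refine (tendsto_sub_atTop_nat j).eventually (p := fun n => (P j n).eval c ≠ 0) ?_
    filter_upwards [(hlim 0 j hj').eventually_ne (hC 0 j hj')] with n hn h0
    simp [h0] at hn
  obtain ⟨N, hN⟩ := eventually_atTop.1 (hne.and (eventually_ge_atTop (r + 1)))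
  have hex : ∀ n ≥ N, ∃ a : ℕ → ℝ, q n = ∑ j ∈ Finset.range (r + 2),
      Polynomial.C (a j) * (X - Polynomial.C c) ^ j * P j (n - j) := fun n hn =>
    exists_connection_coefficients L c r n (hN n hn).2 P hP'
      (fun j hj => (hN n hn).1 j (Finset.mem_range.2 (hj.trans (Nat.lt_succ_self _))))
      (q n) (hq'.degree_eq n).le
      fun t ht => hq'.apply_mul_X_sub_C_pow_eq_zero (hN n hn).2 ht
  choose! lam hlam using hex
  refine ⟨N, lam, fun n hn => ⟨hlam n hn, fun lam' hlam' j hj => ?_⟩, ?_⟩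
  · refine sub_eq_zero.1 (eq_zero_of_sum_X_sub_C_pow_mul_eq_zero c (r + 2)
      (fun j => P j (n - j)) (fun j => lam' j - lam n j)
      (fun j hj => (hN n hn).1 j (Finset.mem_range.2 hj)) ?_ j (Nat.lt_succ_iff.2 hj))
    simp only [Polynomial.C_sub, sub_mul, Finset.sum_sub_distrib]
    rw [← hlam', ← hlam n hn, sub_self]
  obtain ⟨Y, hY, hY0, hY1⟩ := tendsto_evalDeriv_sobolev L c r hM (p := P 0)
    (by simpa using hP' 0 (Nat.zero_le _)) hq' hf hf0 (fun k => hC k 0 (Nat.zero_le _))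
    (fun k => by simpa using hlim' k 0 (Nat.zero_le _))
  set A' : ℕ → ℕ → ℝ := fun k j =>
    (k.factorial / (k - j).factorial : ℝ) * (C (k - j) j * (-1) ^ j) with hA'
  have hdiag : ∀ k ≤ r + 1, A' k k ≠ 0 := fun k hk =>
    mul_ne_zero (by positivity) (mul_ne_zero (hC _ k hk) (pow_ne_zero _ (by norm_num)))
  obtain ⟨l, hl, hYl⟩ := exists_tendsto_of_triangular (R := r + 1) (lam := lam) (A' := A')
    (A := fun k j n => evalDeriv c k ((X - Polynomial.C c) ^ j * P j (n - j)) /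
      ((-1 : ℝ) ^ n * (n : ℝ) ^ f k))
    (fun k hk j hj => by
      simp only [evalDeriv_X_sub_C_pow_mul, if_pos hj, mul_div_assoc]
      have h := hlim' (k - j) j (hj.trans hk)
      rw [Nat.sub_add_cancel hj] at h
      exact (tendsto_shift_div_rpow j h).const_mul _)
    hdiag (fun k _ => hY k)
    (fun k hk => by
      filter_upwards [eventually_ge_atTop N] with n hn
      conv_lhs => rw [hlam n hn]
      rw [map_sum, Finset.sum_div]
      refine (Finset.sum_subset_zero_on_sdiff
        (Finset.range_subset_range.2 (by omega)) (fun j hj => ?_) fun j _ => ?_).symm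
      · have hkj : ¬ j ≤ k := fun h =>
          (Finset.mem_sdiff.1 hj).2 (Finset.mem_range.2 (Nat.lt_succ_iff.2 h))
        rw [mul_assoc, ← smul_eq_C_mul, map_smul, evalDeriv_X_sub_C_pow_mul, if_neg hkj, smul_zero,
          zero_div]
      · rw [mul_assoc, ← smul_eq_C_mul, map_smul, smul_eq_mul]
        ring)
  refine fun j hj => ⟨l j, hl j hj, fun hMpos => ?_⟩
  have hzero : ∀ k ≤ r, l k = 0 := by
    intro k
    induction k using Nat.strong_induction_on with
    | _ k ih =>
      intro hk
      have h := hYl k (hk.trans r.le_succ)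
      rw [hY0 k hk (hMpos k hk), Finset.sum_range_succ, Finset.sum_eq_zero, zero_add] at h
      · exact (mul_eq_zero.1 h.symm).resolve_left (hdiag k (hk.trans r.le_succ))
      · intro i hi
        rw [ih i (Finset.mem_range.1 hi) ((Finset.mem_range.1 hi).le.trans hk), mul_zero]
  refine ⟨hzero j, ?_⟩
  rintro rfl h0
  refine hY1 (r + 1) r.lt_succ_self ?_
  rw [hYl (r + 1) le_rfl, Finset.sum_range_succ, h0, mul_zero, add_zero]
  refine Finset.sum_eq_zero fun i hi => ?_
  rw [hzero i (Nat.lt_succ_iff.1 (Finset.mem_range.1 hi)), mul_zero]
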